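/- (Bottom-up optimality condition 2) In the three-level problem, if a feasible schedule has makespan equal to lb⁻ = OPT(I^{2−}) or to lb⁺ = OPT(I^{2+}), then it is optimal for the original instance I. -/

import Mathlib

/-- Feasibility of a schedule of F-shaped tasks. -/
def Feasible {ι : Type*} (X : ι → ℕ) (p : ι → ℕ → ℕ) (s : ι → ℕ) : Prop :=
  ∀ i j, i ≠ j →
    s i + p i (min (X i) (X j)) ≤ s j ∨ s j + p j (min (X i) (X j)) ≤ s i

/-- Makespan of a schedule. -/
def makespan {ι : Type*} [Fintype ι] (X : ι → ℕ) (p : ι → ℕ → ℕ) (s : ι → ℕ) : ℕ :=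
  Finset.univ.sup fun i => s i + p i (X i)

/-- A valid set of F-shaped tasks with criticalities in {1,…,L} and strictly
increasing processing times on levels 1..X i. -/
def ValidInstance {ι : Type*} (L : ℕ) (X : ι → ℕ) (p : ι → ℕ → ℕ) : Prop :=
  ∀ i, 1 ≤ X i ∧ X i ≤ L ∧ StrictMonoOn (p i) (Set.Icc 1 (X i))

/-- in the three-level problem, a feasible schedule whose makespan
equals lb⁻ = OPT(I^{2−}) or lb⁺ = OPT(I^{2+}) is optimal. -/
theorem stmt14 (n : ℕ) (X : Fin n → ℕ) (p : Fin n → ℕ → ℕ)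
    (hI : ValidInstance 3 X p) (s : Fin n → ℕ) (hs : Feasible X p s)
    (hopt :
      makespan X p s =
        sInf {C | ∃ s', Feasible (fun i => min 2 (X i)) p s' ∧
          makespan (fun i => min 2 (X i)) p s' = C} ∨
      makespan X p s =
        sInf {C | ∃ s' : {i : Fin n // 2 ≤ X i} → ℕ,
          Feasible (fun i : {i : Fin n // 2 ≤ X i} => X i.1 - 1)
            (fun i ℓ => p i.1 (ℓ + 1)) s' ∧
          makespan (fun i : {i : Fin n // 2 ≤ X i} => X i.1 - 1)
            (fun i ℓ => p i.1 (ℓ + 1)) s' = C}) :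
    ∀ s', Feasible X p s' → makespan X p s ≤ makespan X p s' := by
  have hm : ∀ i a b, 1 ≤ a → a ≤ b → b ≤ X i → p i a ≤ p i b := by
    intro i a b ha hab hb
    exact (hI i).2.2.monotoneOn ⟨ha, hab.trans hb⟩ ⟨ha.trans hab, hb⟩ hab
  intro s' hs'
  have hle : ∀ i, s' i + p i (X i) ≤ makespan X p s' := fun i =>
    Finset.le_sup (f := fun i => s' i + p i (X i)) (Finset.mem_univ i)
  rcases hopt with h | h
  · rw [h]
    refine le_trans (Nat.sInf_le ⟨s', ?_, rfl⟩) ?_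
    · intro i j hij
      have h1 := (hI i).1
      have h2 := (hI j).1
      have h3 := hm i (min (min 2 (X i)) (min 2 (X j))) (min (X i) (X j))
        (by omega) (by omega) (by omega)
      have h4 := hm j (min (min 2 (X i)) (min 2 (X j))) (min (X i) (X j))
        (by omega) (by omega) (by omega)
      have h5 := hs' i j hij
      show _ + p i (min (min 2 (X i)) (min 2 (X j))) ≤ _ ∨
        _ + p j (min (min 2 (X i)) (min 2 (X j))) ≤ _
      omega
    · refine Finset.sup_le fun i _ => ?_
      have h1 := (hI i).1
      have h3 := hm i (min 2 (X i)) (X i) (by omega) (by omega) (by omega)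
      have h4 := hle i
      show s' i + p i (min 2 (X i)) ≤ _
      omega
  · rw [h]
    refine le_trans (Nat.sInf_le ⟨fun i => s' i.1, ?_, rfl⟩) ?_
    · rintro ⟨i, hi⟩ ⟨j, hj⟩ hij
      have hij' : i ≠ j := fun e => hij (Subtype.ext e)
      have h5 := hs' i j hij'
      have e : min (X i - 1) (X j - 1) + 1 = min (X i) (X j) := by omega
      show s' i + p i (min (X i - 1) (X j - 1) + 1) ≤ s' j ∨
        s' j + p j (min (X i - 1) (X j - 1) + 1) ≤ s' i
      rw [e]
      exact h5
    · refine Finset.sup_le ?_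
      rintro ⟨i, hi⟩ _
      have e : X i - 1 + 1 = X i := by omega
      show s' i + p i (X i - 1 + 1) ≤ _
      rw [e]
      exact hle i
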